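/- For any constants H0, m, M, g, L > 0, every twice continuously differentiable function s : ℝ → ℝ satisfying H0·s''(x) = (M + m·√(1 + s'(x)²))·g on ℝ with s'(L/2) = 0 is symmetric with respect to x = L/2, i.e. s(x) = s(L − x) for all x ∈ ℝ. -/

import Mathlib

theorem lipschitzWith_sqrt_one_add_sq : LipschitzWith 1 fun x : ℝ => √(1 + x ^ 2) := by
  refine LipschitzWith.of_le_add fun x y => ?_
  rw [Real.dist_eq]
  have hy : |y| ≤ √(1 + y ^ 2) := Real.abs_le_sqrt (by linarith)
  have hsq : √(1 + y ^ 2) ^ 2 = 1 + y ^ 2 := Real.sq_sqrt (by positivity)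
  have hx : |x| ≤ |y| + |x - y| := by
    simpa using abs_add_le y (x - y)
  refine Real.sqrt_le_iff.mpr ⟨by positivity, ?_⟩
  have h₁ := pow_le_pow_left₀ (abs_nonneg x) hx 2
  have h₂ := mul_le_mul_of_nonneg_right hy (abs_nonneg (x - y))
  nlinarith [sq_abs x, sq_abs y]

/-- A solution of an autonomous ODE with an even Lipschitz vector field that vanishes at `c / 2`
is odd about `c / 2`. -/
theorem eq_neg_reflect_of_hasDerivAt {K : NNReal} {F u : ℝ → ℝ} {c : ℝ} (hF : LipschitzWith K F)
    (hF_even : F.Even) (hu : ∀ x, HasDerivAt u (F (u x)) x) (hc : u (c / 2) = 0) (x : ℝ) :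
    u x = -u (c - x) := by
  have hv (t : ℝ) : HasDerivAt (fun t => -u (c - t)) (F (-u (c - t))) t := by
    rw [hF_even]
    exact ((hu (c - t)).comp_const_sub c t).neg.congr_deriv (neg_neg _)
  refine congrFun (ODE_solution_unique_univ (v := fun _ => F) (s := fun _ => Set.univ)
    (t₀ := c / 2) (fun _ => hF.lipschitzOnWith) (fun t => ⟨hu t, trivial⟩)
    (fun t => ⟨hv t, trivial⟩) ?_) x
  simp [sub_half, hc]

theorem cable_ivp_symmetric
    (H0 m M g L : ℝ)
    (hH0 : 0 < H0) (hm : 0 < m) (hM : 0 < M) (hg : 0 < g) (hL : 0 < L)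
    (s : ℝ → ℝ)
    (hs : ContDiff ℝ 2 s)
    (hode : ∀ x : ℝ,
      H0 * deriv (deriv s) x = (M + m * Real.sqrt (1 + (deriv s x) ^ 2)) * g)
    (hd : deriv s (L / 2) = 0) :
    ∀ x : ℝ, s x = s (L - x) := by
  have hs₁ : Differentiable ℝ s := hs.differentiable (by norm_num)
  have hs₂ : Differentiable ℝ (deriv s) :=
    (hs.iterate_deriv' 1 1).differentiable (by norm_num)
  have hF : LipschitzWith (‖m * g / H0‖₊ * 1)
      fun u : ℝ => M * g / H0 + m * g / H0 * √(1 + u ^ 2) := by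
    refine LipschitzWith.of_dist_le_mul fun u v => ?_
    have h := lipschitzWith_sqrt_one_add_sq.dist_le_mul u v
    rw [dist_add_left, Real.dist_eq, ← mul_sub, abs_mul, mul_one, coe_nnnorm, Real.norm_eq_abs]
    gcongr
    simpa [Real.dist_eq] using h
  have hodd := eq_neg_reflect_of_hasDerivAt hF (fun u => by simp)
    (fun x => (hs₂ x).hasDerivAt.congr_deriv (by field_simp; linear_combination hode x)) hd
  have hdiff (x : ℝ) : HasDerivAt (fun x => s x - s (L - x)) 0 x := by
    refine ((hs₁ x).hasDerivAt.sub
      ((hs₁ (L - x)).hasDerivAt.comp_const_sub L x)).congr_deriv ?_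
    linear_combination hodd x
  intro x
  have h := is_const_of_deriv_eq_zero (fun y => (hdiff y).differentiableAt)
    (fun y => (hdiff y).deriv) x (L / 2)
  simp only [sub_half, sub_self] at h
  linarith
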